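/- arXiv:2605.27256 — 3 statements merged into one kernel-verified Lean document; each statement's English description precedes it below -/
import Mathlib

section
/- Let d ≥ 3 be an integer, l ∈ ℕ, and let Δ, Δ_φ be real numbers such that each of c₁ = (Δ_φ + 2Δ − d)/2, c₂ = (Δ_φ − 2Δ + d)/2, c₃ = (d − Δ_φ)/2 lies in (0, d/2). Then for every x ∈ ℝ^d with x ≠ 0 and every q ∈ (0,1): q^Δ ∫_{ℝ^d} V_{d−Δ, Δ_φ, Δ}(x₀, x, q·x₀) · Ĉ_l^{(d/2−1)}( ⟨Ẑ(x | x₀, q·x₀), x/‖x‖⟩ ) dx₀ = q^{d−Δ} (1−q)^{Δ_φ−d} ∫_{ℝ^d} ‖x₀ − x‖^{−2c₁} ‖x₀ − q·x‖^{−2c₂} ‖x₀‖^{−2c₃} · Ĉ_l^{(d/2−1)}( ⟨Ẑ(x₀ | x, q·x), x₀/‖x₀‖⟩ ) dx₀, with both integrals absolutely convergent. (This identifies the spin-l one-point thermal conformal partial wave with the bulk-channel two-point defect conformal partial wave for a point-like defect with spin-l exchange, in the diagonal configuration.) -/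
open MeasureTheory
open scoped BigOperators RealInnerProductSpace

/-- Pochhammer symbol `(a)_n = a (a+1) ⋯ (a+n-1)`. -/
noncomputable def poch (a : ℝ) (n : ℕ) : ℝ := ∏ i ∈ Finset.range n, (a + i)

/-- Gegenbauer polynomial
`C_l^{(ε)}(t) = Σ_{k=0}^{⌊l/2⌋} (-1)^k (ε)_{l-k} (2t)^{l-2k} / (k! (l-2k)!)`. -/
noncomputable def gegenbauerC (ε : ℝ) (l : ℕ) (t : ℝ) : ℝ :=
  ∑ k ∈ Finset.range (l / 2 + 1),
    (-1 : ℝ) ^ k * poch ε (l - k) * (2 * t) ^ (l - 2 * k) /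
      (k.factorial * (l - 2 * k).factorial)

/-- Normalized Gegenbauer polynomial `Ĉ_l^{(ε)}(t) = (l!/(2^l (ε)_l)) C_l^{(ε)}(t)`. -/
noncomputable def gegenbauerHat (ε : ℝ) (l : ℕ) (t : ℝ) : ℝ :=
  (l.factorial : ℝ) / (2 ^ l * poch ε l) * gegenbauerC ε l t

/-- Kinematic part of a scalar three-point function:
`V_{Δa Δb Δc}(ya, yb, yc) = ‖ya-yb‖^{Δc-Δa-Δb} ‖ya-yc‖^{Δb-Δa-Δc} ‖yb-yc‖^{Δa-Δb-Δc}`. -/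
noncomputable def Vthree (d : ℕ) (Δa Δb Δc : ℝ)
    (ya yb yc : EuclideanSpace ℝ (Fin d)) : ℝ :=
  ‖ya - yb‖ ^ (Δc - Δa - Δb) * ‖ya - yc‖ ^ (Δb - Δa - Δc) * ‖yb - yc‖ ^ (Δa - Δb - Δc)

/-- The conformal three-point vector structure
`Z(xᵢ|xⱼ,xₖ) = (xᵢ-xⱼ)/‖xᵢ-xⱼ‖² - (xᵢ-xₖ)/‖xᵢ-xₖ‖²`. -/
noncomputable def Zvec {d : ℕ} (xi xj xk : EuclideanSpace ℝ (Fin d)) :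
    EuclideanSpace ℝ (Fin d) :=
  (‖xi - xj‖ ^ 2)⁻¹ • (xi - xj) - (‖xi - xk‖ ^ 2)⁻¹ • (xi - xk)

/-- The unit vector `Ẑ(xᵢ|xⱼ,xₖ) = Z(xᵢ|xⱼ,xₖ)/‖Z(xᵢ|xⱼ,xₖ)‖`. -/
noncomputable def Zhat {d : ℕ} (xi xj xk : EuclideanSpace ℝ (Fin d)) :
    EuclideanSpace ℝ (Fin d) :=
  ‖Zvec xi xj xk‖⁻¹ • Zvec xi xj xk

lemma exists_norm_sub_rpow_le_one_add_norm_rpow {E : Type*} [NormedAddCommGroup E]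
    {a : ℝ} (ha : 0 ≤ a) (p : E) {r : ℝ}
    (hr : 0 < r) :
    ∃ K : ℝ, 0 ≤ K ∧ ∀ y : E, r ≤ ‖y - p‖ → ‖y - p‖ ^ (-a) ≤ K * (1 + ‖y‖) ^ (-a) := by
  set M : ℝ := (1 + ‖p‖) / r + 1 with hM
  have hM0 : 0 < M := by positivity
  refine ⟨M⁻¹ ^ (-a), by positivity, fun y hy => ?_⟩
  rw [← Real.mul_rpow (by positivity) (by positivity)]
  refine Real.rpow_le_rpow_of_nonpos (by positivity) ?_ (by linarith)
  rw [inv_mul_le_iff₀ hM0]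
  have h1 : ‖y‖ ≤ ‖y - p‖ + ‖p‖ := by simpa using norm_add_le (y - p) p
  have h2 : 1 + ‖p‖ ≤ (1 + ‖p‖) / r * ‖y - p‖ := by
    rw [div_mul_eq_mul_div, le_div_iff₀ hr]
    gcongr
  rw [hM]
  linarith

section Integrability

open Metric Module

variable {E : Type*} [NormedAddCommGroup E] [NormedSpace ℝ E] [FiniteDimensional ℝ E]
  [MeasurableSpace E] [BorelSpace E] (μ : Measure E) [μ.IsAddHaarMeasure]

lemma integrableOn_ball_norm_sub_rpow [Nontrivial E] {a : ℝ} (ha : a < finrank ℝ E) (p : E)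
    {r : ℝ} (hr : 0 < r) :
    IntegrableOn (fun y : E => ‖y - p‖ ^ (-a)) (ball p r) μ := by
  have h0 : IntegrableOn (fun y : E => ‖y‖ ^ (-a)) (ball 0 r) μ := by
    rw [integrableOn_fun_norm_addHaar μ (f := fun t : ℝ => t ^ (-a))]
    have h1 : IntegrableOn (fun t : ℝ => t ^ ((finrank ℝ E : ℝ) - 1 - a)) (Set.Ioo 0 r) := by
      rw [intervalIntegral.integrableOn_Ioo_rpow_iff hr]
      linarith
    refine h1.congr_fun (fun t ht => ?_) measurableSet_Ioo
    have hE : 1 ≤ finrank ℝ E := finrank_pos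
    simp only [smul_eq_mul]
    rw [← Real.rpow_natCast, ← Real.rpow_add ht.1, Nat.cast_sub hE]
    congr 1
    push_cast
    ring
  rw [← integrable_indicator_iff measurableSet_ball] at h0 ⊢
  refine (h0.comp_sub_right p).congr (.of_forall fun y => ?_)
  simp [Set.indicator, dist_eq_norm]

lemma integrableOn_ball_mul_norm_sub_rpow [Nontrivial E] {a b c : ℝ} (ha : a < finrank ℝ E)
    (hb : 0 ≤ b) (hc : 0 ≤ c) {p₁ p₂ p₃ : E} {r : ℝ} (hr : 0 < r)
    (h₂ : 2 * r ≤ ‖p₁ - p₂‖) (h₃ : 2 * r ≤ ‖p₁ - p₃‖) :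
    IntegrableOn (fun y : E => ‖y - p₁‖ ^ (-a) * ‖y - p₂‖ ^ (-b) * ‖y - p₃‖ ^ (-c))
      (ball p₁ r) μ := by
  refine ((integrableOn_ball_norm_sub_rpow μ ha p₁ hr).mul_const (r ^ (-b) * r ^ (-c))).mono'
    (by fun_prop) ?_
  refine ae_restrict_of_forall_mem measurableSet_ball fun y hy => ?_
  rw [mem_ball, dist_eq_norm] at hy
  have key : ∀ p : E, 2 * r ≤ ‖p₁ - p‖ → r ≤ ‖y - p‖ := fun p hp => by
    have := norm_sub_le_norm_sub_add_norm_sub p₁ y p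
    rw [norm_sub_rev p₁ y] at this
    linarith
  rw [Real.norm_of_nonneg (by positivity), mul_assoc]
  gcongr ?_ * (?_ * ?_)
  · exact Real.rpow_le_rpow_of_nonpos hr (key _ h₂) (by linarith)
  · exact Real.rpow_le_rpow_of_nonpos hr (key _ h₃) (by linarith)

/-- A product of three inverse powers of distances to distinct points is integrable as soon as
each power is locally integrable and the total power is integrable at infinity. -/
lemma integrable_mul_norm_sub_rpow [Nontrivial E] {a b c : ℝ}
    (ha : a < finrank ℝ E) (hb : b < finrank ℝ E) (hc : c < finrank ℝ E)
    (ha' : 0 ≤ a) (hb' : 0 ≤ b) (hc' : 0 ≤ c) (habc : finrank ℝ E < a + b + c)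
    {p₁ p₂ p₃ : E} (h₁₂ : p₁ ≠ p₂) (h₁₃ : p₁ ≠ p₃) (h₂₃ : p₂ ≠ p₃) :
    Integrable (fun y : E => ‖y - p₁‖ ^ (-a) * ‖y - p₂‖ ^ (-b) * ‖y - p₃‖ ^ (-c)) μ := by
  obtain ⟨r, hr, hr₁₂, hr₁₃, hr₂₃⟩ : ∃ r : ℝ, 0 < r ∧ 2 * r ≤ ‖p₁ - p₂‖ ∧ 2 * r ≤ ‖p₁ - p₃‖ ∧
      2 * r ≤ ‖p₂ - p₃‖ := by
    have h1 := norm_sub_pos_iff.2 h₁₂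
    have h2 := norm_sub_pos_iff.2 h₁₃
    have h3 := norm_sub_pos_iff.2 h₂₃
    refine ⟨min ‖p₁ - p₂‖ (min ‖p₁ - p₃‖ ‖p₂ - p₃‖) / 2, by positivity, ?_, ?_, ?_⟩ <;>
      rw [mul_div_cancel₀ _ two_ne_zero] <;> simp
  have I₁ := integrableOn_ball_mul_norm_sub_rpow μ ha hb' hc' hr hr₁₂ hr₁₃
  have I₂ := integrableOn_ball_mul_norm_sub_rpow μ hb ha' hc' hr
    (norm_sub_rev p₁ p₂ ▸ hr₁₂) hr₂₃
  have I₃ := integrableOn_ball_mul_norm_sub_rpow μ hc ha' hb' hr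
    (norm_sub_rev p₁ p₃ ▸ hr₁₃) (norm_sub_rev p₂ p₃ ▸ hr₂₃)
  obtain ⟨K₁, hK₁, H₁⟩ := exists_norm_sub_rpow_le_one_add_norm_rpow ha' p₁ hr
  obtain ⟨K₂, hK₂, H₂⟩ := exists_norm_sub_rpow_le_one_add_norm_rpow hb' p₂ hr
  obtain ⟨K₃, hK₃, H₃⟩ := exists_norm_sub_rpow_le_one_add_norm_rpow hc' p₃ hr
  set B : Set E := ball p₁ r ∪ (ball p₂ r ∪ ball p₃ r) with hB
  have hBm : MeasurableSet B := by measurability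
  have IB : IntegrableOn (fun y : E => ‖y - p₁‖ ^ (-a) * ‖y - p₂‖ ^ (-b) * ‖y - p₃‖ ^ (-c))
      B μ := by
    refine I₁.union (IntegrableOn.union ?_ ?_)
    · exact I₂.congr_fun (fun y _ => by ring) measurableSet_ball
    · exact I₃.congr_fun (fun y _ => by ring) measurableSet_ball
  have IBc : IntegrableOn (fun y : E => ‖y - p₁‖ ^ (-a) * ‖y - p₂‖ ^ (-b) * ‖y - p₃‖ ^ (-c))
      Bᶜ μ := by
    refine ((integrable_one_add_norm (μ := μ) habc).const_mul
      (K₁ * K₂ * K₃)).integrableOn.mono' (by fun_prop) ?_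
    refine ae_restrict_of_forall_mem hBm.compl fun y hy => ?_
    simp only [hB, Set.mem_compl_iff, Set.mem_union, mem_ball, dist_eq_norm, not_or,
      not_lt] at hy
    have hy0 : 0 < 1 + ‖y‖ := by positivity
    rw [Real.norm_of_nonneg (by positivity)]
    calc ‖y - p₁‖ ^ (-a) * ‖y - p₂‖ ^ (-b) * ‖y - p₃‖ ^ (-c)
        ≤ K₁ * (1 + ‖y‖) ^ (-a) * (K₂ * (1 + ‖y‖) ^ (-b)) * (K₃ * (1 + ‖y‖) ^ (-c)) := by
          gcongr
          · exact H₁ y hy.1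
          · exact H₂ y hy.2.1
          · exact H₃ y hy.2.2
      _ = K₁ * K₂ * K₃ * (1 + ‖y‖) ^ (-(a + b + c)) := by
          rw [show -(a + b + c) = -a + -b + -c by ring, Real.rpow_add hy0, Real.rpow_add hy0]
          ring
  rw [← integrableOn_univ, ← Set.union_compl_self B]
  exact IB.union IBc

end Integrability

lemma continuous_gegenbauerHat (ε : ℝ) (l : ℕ) : Continuous (gegenbauerHat ε l) := by
  unfold gegenbauerHat gegenbauerC
  fun_prop

lemma exists_bound_gegenbauerHat (ε : ℝ) (l : ℕ) :
    ∃ M : ℝ, ∀ t : ℝ, |t| ≤ 1 → ‖gegenbauerHat ε l t‖ ≤ M := by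
  obtain ⟨M, hM⟩ := (isCompact_Icc (a := (-1 : ℝ)) (b := 1)).exists_bound_of_continuousOn
    (continuous_gegenbauerHat ε l).continuousOn
  exact ⟨M, fun t ht => hM t (abs_le.1 ht)⟩

section Zvec

variable {d : ℕ}

lemma norm_inv_norm_smul_le_one {F : Type*} [NormedAddCommGroup F] [NormedSpace ℝ F] (v : F) :
    ‖‖v‖⁻¹ • v‖ ≤ 1 := by
  rw [norm_smul, norm_inv, norm_norm]
  exact inv_mul_le_one

lemma abs_inner_Zhat_le_one (a b c v : EuclideanSpace ℝ (Fin d)) :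
    |⟪Zhat a b c, ‖v‖⁻¹ • v⟫| ≤ 1 :=
  (abs_real_inner_le_norm _ _).trans
    (mul_le_one₀ (norm_inv_norm_smul_le_one _) (norm_nonneg _) (norm_inv_norm_smul_le_one _))

lemma norm_Zvec {a b c : EuclideanSpace ℝ (Fin d)} (hb : a ≠ b) (hc : a ≠ c) :
    ‖Zvec a b c‖ = ‖b - c‖ / (‖a - b‖ * ‖a - c‖) := by
  have h := dist_div_norm_sq_smul (sub_ne_zero.2 hb) (sub_ne_zero.2 hc) 1
  simp only [dist_eq_norm, one_div, inv_pow, one_pow, sub_sub_sub_cancel_left] at h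
  rw [Zvec, h, norm_sub_rev c b]
  ring

lemma inner_Zhat (a b c v : EuclideanSpace ℝ (Fin d)) (hb : a ≠ b) (hc : a ≠ c) :
    ⟪Zhat a b c, ‖v‖⁻¹ • v⟫ = ‖a - b‖ * ‖a - c‖ / (‖b - c‖ * ‖v‖) *
      (⟪a - b, v⟫ / ‖a - b‖ ^ 2 - ⟪a - c, v⟫ / ‖a - c‖ ^ 2) := by
  rw [Zhat, norm_Zvec hb hc, Zvec]
  simp only [inner_smul_left, inner_smul_right, inner_sub_left (𝕜 := ℝ) (_ • _),
    RCLike.conj_to_real]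
  rw [inv_div]
  ring

/-- The thermal and the defect three-point structures agree after rescaling. -/
lemma inner_Zhat_smul_eq {x y : EuclideanSpace ℝ (Fin d)} {q : ℝ} (hq : q ∈ Set.Ioo (0 : ℝ) 1)
    (hyx : q • y ≠ x) (hy : y ≠ x) :
    ⟪Zhat x y (q • y), ‖x‖⁻¹ • x⟫ = ⟪Zhat (q • y) x (q • x), ‖q • y‖⁻¹ • (q • y)⟫ := by
  obtain ⟨hq0, hq1⟩ := hq
  have hqy : q • y ≠ q • x := fun h => hy (smul_right_injective _ hq0.ne' h)
  rw [inner_Zhat _ _ _ _ hy.symm hyx.symm, inner_Zhat _ _ _ _ hyx hqy]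
  have n1 : ‖q • y - q • x‖ = q * ‖x - y‖ := by
    rw [← smul_sub, norm_smul, Real.norm_of_nonneg hq0.le, norm_sub_rev]
  have n2 : ∀ z : EuclideanSpace ℝ (Fin d), ‖z - q • z‖ = (1 - q) * ‖z‖ := fun z => by
    rw [show z - q • z = (1 - q) • z by module, norm_smul,
      Real.norm_of_nonneg (by linarith)]
  rw [n1, n2, n2, norm_smul, Real.norm_of_nonneg hq0.le, norm_sub_rev (q • y) x]
  have hA : ‖x - y‖ ≠ 0 := norm_ne_zero_iff.2 (sub_ne_zero.2 hy.symm)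
  have hB : ‖x - q • y‖ ≠ 0 := norm_ne_zero_iff.2 (sub_ne_zero.2 hyx.symm)
  have key : ⟪x - y, x⟫ / ‖x - y‖ ^ 2 - ⟪x - q • y, x⟫ / ‖x - q • y‖ ^ 2 =
      ⟪q • y - x, q • y⟫ / ‖x - q • y‖ ^ 2 - ⟪q • y - q • x, q • y⟫ / (q * ‖x - y‖) ^ 2 := by
    have e1 : ⟪x - y, x⟫ + ⟪q • y - q • x, q • y⟫ / q ^ 2 = ‖x - y‖ ^ 2 := by
      rw [← real_inner_self_eq_norm_sq]
      simp only [inner_sub_left, inner_sub_right, inner_smul_left, inner_smul_right,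
        RCLike.conj_to_real, real_inner_comm x y]
      field_simp
      ring
    have e2 : ⟪x - q • y, x⟫ + ⟪q • y - x, q • y⟫ = ‖x - q • y‖ ^ 2 := by
      rw [← real_inner_self_eq_norm_sq]
      simp only [inner_sub_left, inner_sub_right, inner_smul_left, inner_smul_right,
        RCLike.conj_to_real, real_inner_comm x y]
      ring
    rw [eq_sub_of_add_eq e1, eq_sub_of_add_eq e2]
    field_simp
    ring
  rw [key]
  field_simp

end Zvec

/-- The spin-`l` one-point thermal conformal partial wave coincides with the
bulk-channel two-point defect conformal partial wave for a point-like defect with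
spin-`l` exchange, in the diagonal configuration `x₁ = x`, `x₂ = qx`:
`q^Δ ∫ V_{d-Δ,Δφ,Δ}(x₀,x,qx₀) Ĉ_l^{(d/2-1)}(⟨Ẑ(x|x₀,qx₀), x/‖x‖⟩) dx₀
 = q^{d-Δ}(1-q)^{Δφ-d} ∫ ‖x₀-x‖^{-2c₁}‖x₀-qx‖^{-2c₂}‖x₀‖^{-2c₃}
     Ĉ_l^{(d/2-1)}(⟨Ẑ(x₀|x,qx), x₀/‖x₀‖⟩) dx₀`,
with both integrals absolutely convergent. -/
theorem spinning_thermal_CPW_eq_defect_CPW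
    (d : ℕ) (hd : 3 ≤ d) (l : ℕ) (Δ Δφ : ℝ)
    (hc₁ : (Δφ + 2 * Δ - d) / 2 ∈ Set.Ioo (0 : ℝ) ((d : ℝ) / 2))
    (hc₂ : (Δφ - 2 * Δ + d) / 2 ∈ Set.Ioo (0 : ℝ) ((d : ℝ) / 2))
    (hc₃ : ((d : ℝ) - Δφ) / 2 ∈ Set.Ioo (0 : ℝ) ((d : ℝ) / 2))
    (x : EuclideanSpace ℝ (Fin d)) (hx : x ≠ 0)
    (q : ℝ) (hq : q ∈ Set.Ioo (0 : ℝ) 1) :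
    Integrable (fun x₀ : EuclideanSpace ℝ (Fin d) =>
      Vthree d ((d : ℝ) - Δ) Δφ Δ x₀ x (q • x₀) *
        gegenbauerHat ((d : ℝ) / 2 - 1) l ⟪Zhat x x₀ (q • x₀), ‖x‖⁻¹ • x⟫) ∧
    Integrable (fun x₀ : EuclideanSpace ℝ (Fin d) =>
      ‖x₀ - x‖ ^ (-(Δφ + 2 * Δ - (d : ℝ))) * ‖x₀ - q • x‖ ^ (-(Δφ - 2 * Δ + (d : ℝ))) *
        ‖x₀‖ ^ (-((d : ℝ) - Δφ)) *
        gegenbauerHat ((d : ℝ) / 2 - 1) l ⟪Zhat x₀ x (q • x), ‖x₀‖⁻¹ • x₀⟫) ∧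
    q ^ Δ * ∫ x₀ : EuclideanSpace ℝ (Fin d),
        Vthree d ((d : ℝ) - Δ) Δφ Δ x₀ x (q • x₀) *
          gegenbauerHat ((d : ℝ) / 2 - 1) l ⟪Zhat x x₀ (q • x₀), ‖x‖⁻¹ • x⟫ =
      q ^ ((d : ℝ) - Δ) * (1 - q) ^ (Δφ - (d : ℝ)) *
        ∫ x₀ : EuclideanSpace ℝ (Fin d),
          ‖x₀ - x‖ ^ (-(Δφ + 2 * Δ - (d : ℝ))) *
            ‖x₀ - q • x‖ ^ (-(Δφ - 2 * Δ + (d : ℝ))) * ‖x₀‖ ^ (-((d : ℝ) - Δφ)) *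
            gegenbauerHat ((d : ℝ) / 2 - 1) l ⟪Zhat x₀ x (q • x), ‖x₀‖⁻¹ • x₀⟫ := by
  obtain ⟨hc₁0, hc₁d⟩ := hc₁
  obtain ⟨hc₂0, hc₂d⟩ := hc₂
  obtain ⟨hc₃0, hc₃d⟩ := hc₃
  have hq0 := hq.1
  have hq1 : 0 < 1 - q := by linarith [hq.2]
  have : Nontrivial (EuclideanSpace ℝ (Fin d)) := ⟨x, 0, hx⟩
  set F : EuclideanSpace ℝ (Fin d) → ℝ := fun x₀ =>
      ‖x₀ - x‖ ^ (-(Δφ + 2 * Δ - (d : ℝ))) * ‖x₀ - q • x‖ ^ (-(Δφ - 2 * Δ + (d : ℝ))) *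
        ‖x₀‖ ^ (-((d : ℝ) - Δφ)) *
        gegenbauerHat ((d : ℝ) / 2 - 1) l ⟪Zhat x₀ x (q • x), ‖x₀‖⁻¹ • x₀⟫ with hF
  have hFint : Integrable F := by
    obtain ⟨M, hM⟩ := exists_bound_gegenbauerHat ((d : ℝ) / 2 - 1) l
    refine Integrable.mul_bdd (c := M) ?_ ?_ (.of_forall fun y => hM _ (abs_inner_Zhat_le_one ..))
    · have hxq : x ≠ q • x := fun h => by
        have : (1 - q) • x = 0 := by rw [sub_smul, one_smul, ← h, sub_self]
        exact (smul_ne_zero hq1.ne' hx) this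
      have := integrable_mul_norm_sub_rpow (volume : Measure (EuclideanSpace ℝ (Fin d)))
        (a := Δφ + 2 * Δ - d) (b := Δφ - 2 * Δ + d) (c := d - Δφ)
        (p₁ := x) (p₂ := q • x) (p₃ := 0)
        (by rw [finrank_euclideanSpace_fin]; linarith) (by rw [finrank_euclideanSpace_fin]; linarith)
        (by rw [finrank_euclideanSpace_fin]; linarith) (by linarith) (by linarith) (by linarith)
        (by rw [finrank_euclideanSpace_fin]; linarith) hxq hx (smul_ne_zero hq0.ne' hx)
      simpa only [sub_zero] using this
    · refine ((continuous_gegenbauerHat _ _).measurable.comp ?_).aestronglyMeasurable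
      unfold Zhat Zvec
      fun_prop
  have hpt : ∀ x₀ : EuclideanSpace ℝ (Fin d),
      Vthree d ((d : ℝ) - Δ) Δφ Δ x₀ x (q • x₀) *
        gegenbauerHat ((d : ℝ) / 2 - 1) l ⟪Zhat x x₀ (q • x₀), ‖x‖⁻¹ • x⟫ =
      q ^ (2 * (d : ℝ) - 2 * Δ) * (1 - q) ^ (Δφ - (d : ℝ)) * F (q • x₀) := by
    intro y
    by_cases hyx : q • y = x
    · have h0 : ‖x - q • y‖ = 0 := by rw [hyx, sub_self, norm_zero]
      simp only [hF, Vthree]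
      rw [norm_sub_rev (q • y) x, h0, Real.zero_rpow (by linarith), Real.zero_rpow (by linarith)]
      ring
    by_cases hy : y = x
    · subst hy
      simp only [hF, Vthree, sub_self, norm_zero]
      rw [Real.zero_rpow (by linarith), Real.zero_rpow (by linarith)]
      ring
    simp only [hF, Vthree]
    rw [inner_Zhat_smul_eq hq hyx hy, ← mul_assoc]
    congr 1
    rw [show y - q • y = (1 - q) • y by module, ← smul_sub, norm_smul, norm_smul, norm_smul,
      Real.norm_of_nonneg hq0.le, Real.norm_of_nonneg hq1.le, norm_sub_rev (q • y) x,
      Real.mul_rpow hq1.le (norm_nonneg _), Real.mul_rpow hq0.le (norm_nonneg _),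
      Real.mul_rpow hq0.le (norm_nonneg _),
      show 2 * (d : ℝ) - 2 * Δ = (Δφ - 2 * Δ + d) + (d - Δφ) by ring, Real.rpow_add hq0,
      Real.rpow_neg hq0.le, Real.rpow_neg hq0.le,
      show Δ - (d - Δ) - Δφ = -(Δφ - 2 * Δ + d) by ring,
      show Δφ - (d - Δ) - Δ = Δφ - d by ring,
      show (d : ℝ) - Δ - Δφ - Δ = -(Δφ + 2 * Δ - d) by ring, neg_sub (d : ℝ) Δφ]
    have e1 := (Real.rpow_pos_of_pos hq0 (Δφ - 2 * Δ + d)).ne'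
    have e2 := (Real.rpow_pos_of_pos hq0 (d - Δφ)).ne'
    field_simp
  refine ⟨?_, hFint, ?_⟩
  · simp_rw [hpt]
    exact (hFint.comp_smul hq0.ne').const_mul _
  · simp_rw [hpt]
    rw [integral_const_mul, Measure.integral_comp_smul, finrank_euclideanSpace_fin,
      abs_of_pos (by positivity), smul_eq_mul, ← Real.rpow_natCast, ← Real.rpow_neg hq0.le,
      show (d : ℝ) - Δ = Δ + (2 * d - 2 * Δ) + -d by ring, Real.rpow_add hq0, Real.rpow_add hq0]
    ring
end

section
/- Let d ≥ 1 be an integer and let Δ, Δ_φ be real numbers such that each of c₁ = (Δ_φ + 2Δ − d)/2, c₂ = (Δ_φ − 2Δ + d)/2, c₃ = (d − Δ_φ)/2 lies in (0, d/2). Fix x ∈ ℝ^d with x ≠ 0 and q ∈ (0,1), and define the t-channel flat-space partial wave Ψ(x₁,x₂,x₃,x₄) = ‖x₁ − x₄‖^{−(d−Δ_φ)} · ‖x₂ − x₃‖^{d−2Δ−Δ_φ} · ∫_{ℝ^d} ‖x₀−x₁‖^{−2c₁} ‖x₀−x₂‖^{−2c₂} ‖x₀−x₃‖^{−2c₃}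 ‖x₀−x₄‖^{−2c₃} dx₀, and the thermal partial wave Υ(q,x) = q^Δ ∫_{ℝ^d} V_{d−Δ, Δ_φ, Δ}(x₀, x, q·x₀) dx₀. Then, as ‖y‖ → ∞, the quantity ‖y‖^{2(d−Δ_φ)} · Ψ(x, q·x, 0, y) converges to ‖x‖^{(d−Δ_φ)−2Δ} · q^{−Δ−Δ_φ} · (1−q)^{d−Δ_φ} · Υ(q,x). (This is the statement that the one-point thermal conformal partial wave arises as the diagonal limit x₂ = qx₁, x₃ = 0, x₄ → ∞ of the four-point t-channel flat-space conformal partial wave with external dimensions (Δ, Δ_φ, Δ, d−Δ_φ) and exchanged dimension Δ.) -/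
open MeasureTheory Filter

/-- The `t`-channel flat-space conformal partial wave with external dimensions
`(Δ, Δφ, Δ, d-Δφ)` and exchanged dimension `Δ`, with shadow-formalism exponents
`c₁ = (Δφ+2Δ-d)/2`, `c₂ = (Δφ-2Δ+d)/2`, `c₃ = c₄ = (d-Δφ)/2`. -/
noncomputable def Psi (d : ℕ) (Δ Δφ : ℝ)
    (x₁ x₂ x₃ x₄ : EuclideanSpace ℝ (Fin d)) : ℝ :=
  ‖x₁ - x₄‖ ^ (-((d : ℝ) - Δφ)) * ‖x₂ - x₃‖ ^ ((d : ℝ) - 2 * Δ - Δφ) *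
    ∫ x₀ : EuclideanSpace ℝ (Fin d),
      ‖x₀ - x₁‖ ^ (-(Δφ + 2 * Δ - (d : ℝ))) * ‖x₀ - x₂‖ ^ (-(Δφ - 2 * Δ + (d : ℝ))) *
        ‖x₀ - x₃‖ ^ (-((d : ℝ) - Δφ)) * ‖x₀ - x₄‖ ^ (-((d : ℝ) - Δφ))

/-- The one-point thermal conformal partial wave
`Υ(q,x) = q^Δ ∫ V_{d-Δ,Δφ,Δ}(x₀, x, qx₀) dx₀`. -/
noncomputable def Upsilon (d : ℕ) (Δ Δφ : ℝ) (q : ℝ)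
    (x : EuclideanSpace ℝ (Fin d)) : ℝ :=
  q ^ Δ * ∫ x₀ : EuclideanSpace ℝ (Fin d), Vthree d ((d : ℝ) - Δ) Δφ Δ x₀ x (q • x₀)

section RadialPowers

variable {E : Type*} [NormedAddCommGroup E] [NormedSpace ℝ E] [FiniteDimensional ℝ E]
  [MeasurableSpace E] [BorelSpace E] [Nontrivial E] (μ : Measure E) [μ.IsAddHaarMeasure]

/-- A negative power of the norm is integrable on balls below the critical exponent. -/
lemma integrableOn_ball_norm_rpow_neg {e : ℝ} (he : e < Module.finrank ℝ E) (r : ℝ) :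
    IntegrableOn (fun z : E => ‖z‖ ^ (-e)) (Metric.ball 0 r) μ := by
  rw [integrableOn_fun_norm_addHaar μ (f := fun t => t ^ (-e))]
  have hn : 1 ≤ Module.finrank ℝ E := Module.finrank_pos
  rcases le_or_gt r 0 with hr | hr
  · simp [Set.Ioo_eq_empty_of_le hr]
  have h : IntegrableOn (fun t : ℝ => t ^ ((Module.finrank ℝ E : ℝ) - 1 - e)) (Set.Ioo 0 r) :=
    (intervalIntegral.integrableOn_Ioo_rpow_iff hr).2 (by linarith)
  refine h.congr_fun (fun t ht => ?_) measurableSet_Ioo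
  simp only [smul_eq_mul]
  rw [sub_eq_add_neg, Real.rpow_add ht.1, ← Nat.cast_one, ← Nat.cast_sub hn, Real.rpow_natCast]

/-- A radial function with an integrable power singularity at the origin and integrable power
decay at infinity is integrable. -/
lemma integrable_norm_rpow_mul_max_rpow {e s r : ℝ} (hr : 0 < r)
    (he : e < Module.finrank ℝ E) (hs : Module.finrank ℝ E < s) :
    Integrable (fun z : E => ‖z‖ ^ (-e) * max ‖z‖ r ^ (e - s)) μ := by
  have hn : 1 ≤ Module.finrank ℝ E := Module.finrank_pos
  have h_near : IntegrableOn (fun z : E => ‖z‖ ^ (-e) * max ‖z‖ r ^ (e - s))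
      (Metric.ball 0 r) μ := by
    refine IntegrableOn.congr_fun ((integrableOn_ball_norm_rpow_neg μ he r).mul_const (r ^ (e - s)))
      (fun z hz => ?_) measurableSet_ball
    rw [mem_ball_zero_iff] at hz
    simp only [max_eq_right hz.le]
  refine (integrableOn_iff_integrable_of_support_subset (Set.subset_univ _)).1 ?_
  rw [← Set.union_compl_self (Metric.ball (0 : E) r)]
  refine h_near.union ?_
  have h_far : Integrable (fun z : E => (Set.Ici r).indicator (fun t => t ^ (-s)) ‖z‖) μ := by
    rw [integrable_fun_norm_addHaar μ (f := (Set.Ici r).indicator (fun t => t ^ (-s)))]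
    have h : IntegrableOn (fun t : ℝ => t ^ ((Module.finrank ℝ E : ℝ) - 1 - s)) (Set.Ici r) :=
      (integrableOn_Ici_iff_integrableOn_Ioi (by simp)).2
        (integrableOn_Ioi_rpow_of_lt (by linarith) hr)
    refine ((integrable_indicator_iff measurableSet_Ici).2 h).integrableOn.congr_fun
      (fun t ht => ?_) measurableSet_Ioi
    have ht : 0 < t := ht
    by_cases h : t ∈ Set.Ici r
    · simp only [h, Set.indicator_of_mem, smul_eq_mul]
      rw [sub_eq_add_neg _ s, Real.rpow_add ht, ← Nat.cast_one, ← Nat.cast_sub hn,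
        Real.rpow_natCast]
    · simp [h]
  refine h_far.integrableOn.congr_fun (fun z hz => ?_) measurableSet_ball.compl
  simp only [Set.mem_compl_iff, mem_ball_zero_iff, not_lt] at hz
  have hz' : 0 < ‖z‖ := hr.trans_le hz
  simp only [Set.indicator_of_mem (Set.mem_Ici.2 hz), max_eq_left hz]
  rw [← Real.rpow_add hz']
  ring_nf

end RadialPowers

/-- If `u` is the smallest of three distances and the other two are at least `r`, the product of
negative powers is controlled by `u` alone. -/
lemma rpow_neg_mul_rpow_neg_mul_rpow_neg_le {a b c u v w r : ℝ} (hr : 0 < r)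
    (hb : 0 < b) (hc : 0 < c) (hu : 0 ≤ u) (huv : u ≤ v) (huw : u ≤ w) (hrv : r ≤ v) (hrw : r ≤ w) :
    u ^ (-a) * v ^ (-b) * w ^ (-c) ≤ u ^ (-a) * max u r ^ (a - (a + b + c)) := by
  have hm : 0 < max u r := lt_max_of_lt_right hr
  have hsplit : max u r ^ (a - (a + b + c)) = max u r ^ (-b) * max u r ^ (-c) := by
    rw [← Real.rpow_add hm]; ring_nf
  rw [hsplit, mul_assoc]
  have hv := Real.rpow_le_rpow_of_nonpos hm (max_le huv hrv) (neg_nonpos.2 hb.le)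
  have hw := Real.rpow_le_rpow_of_nonpos hm (max_le huw hrw) (neg_nonpos.2 hc.le)
  have : 0 ≤ w ^ (-c) := Real.rpow_nonneg (hr.le.trans hrw) _
  gcongr

section ThreePoints

variable {E : Type*} [NormedAddCommGroup E]

/-- Three distinct points have pairwise disjoint balls of some common positive radius. -/
lemma exists_pos_le_norm_of_ne {p₁ p₂ p₃ : E} (h₁₂ : p₁ ≠ p₂) (h₁₃ : p₁ ≠ p₃) (h₂₃ : p₂ ≠ p₃) :
    ∃ r > 0, ∀ z : E, (‖z - p₁‖ < r → r ≤ ‖z - p₂‖ ∧ r ≤ ‖z - p₃‖) ∧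
      (‖z - p₂‖ < r → r ≤ ‖z - p₁‖ ∧ r ≤ ‖z - p₃‖) ∧
      (‖z - p₃‖ < r → r ≤ ‖z - p₁‖ ∧ r ≤ ‖z - p₂‖) := by
  have key : ∀ {p p' : E} (z : E), ‖p - p'‖ ≤ ‖z - p‖ + ‖z - p'‖ := fun {p p'} z => by
    simpa [norm_sub_rev, add_comm] using norm_sub_le (z - p') (z - p)
  have h₁ : 0 < ‖p₁ - p₂‖ := norm_pos_iff.2 (sub_ne_zero.2 h₁₂)
  have h₂ : 0 < ‖p₁ - p₃‖ := norm_pos_iff.2 (sub_ne_zero.2 h₁₃)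
  have h₃ : 0 < ‖p₂ - p₃‖ := norm_pos_iff.2 (sub_ne_zero.2 h₂₃)
  refine ⟨min ‖p₁ - p₂‖ (min ‖p₁ - p₃‖ ‖p₂ - p₃‖) / 2, by positivity, fun z => ?_⟩
  have m₁ := min_le_left ‖p₁ - p₂‖ (min ‖p₁ - p₃‖ ‖p₂ - p₃‖)
  have m := min_le_right ‖p₁ - p₂‖ (min ‖p₁ - p₃‖ ‖p₂ - p₃‖)
  have m₂ := m.trans (min_le_left _ _)
  have m₃ := m.trans (min_le_right _ _)
  have k₁ := key (p := p₁) (p' := p₂) z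
  have k₂ := key (p := p₁) (p' := p₃) z
  have k₃ := key (p := p₂) (p' := p₃) z
  refine ⟨fun h => ⟨?_, ?_⟩, fun h => ⟨?_, ?_⟩, fun h => ⟨?_, ?_⟩⟩ <;> linarith

variable [NormedSpace ℝ E] [FiniteDimensional ℝ E] [MeasurableSpace E] [BorelSpace E]
  [Nontrivial E] (μ : Measure E) [μ.IsAddHaarMeasure]

/-- A product of three powers singular at distinct points is integrable when every exponent is
subcritical and the total exponent is supercritical. -/
lemma integrable_three_point_rpow {a b c : ℝ} (ha : a ∈ Set.Ioo 0 (Module.finrank ℝ E : ℝ))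
    (hb : b ∈ Set.Ioo 0 (Module.finrank ℝ E : ℝ)) (hc : c ∈ Set.Ioo 0 (Module.finrank ℝ E : ℝ))
    (habc : Module.finrank ℝ E < a + b + c) {p₁ p₂ p₃ : E}
    (h₁₂ : p₁ ≠ p₂) (h₁₃ : p₁ ≠ p₃) (h₂₃ : p₂ ≠ p₃) :
    Integrable (fun z => ‖z - p₁‖ ^ (-a) * ‖z - p₂‖ ^ (-b) * ‖z - p₃‖ ^ (-c)) μ := by
  obtain ⟨r, hr, hsep⟩ := exists_pos_le_norm_of_ne h₁₂ h₁₃ h₂₃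
  have H : ∀ {e : ℝ} (p : E), e < Module.finrank ℝ E →
      Integrable (fun z => ‖z - p‖ ^ (-e) * max ‖z - p‖ r ^ (e - (a + b + c))) μ := fun p he =>
    (integrable_norm_rpow_mul_max_rpow μ hr he habc).comp_sub_right p
  refine (((H p₁ ha.2).add (H p₂ hb.2)).add (H p₃ hc.2)).mono' ?_ (ae_of_all _ fun z => ?_)
  · exact Measurable.aestronglyMeasurable (by fun_prop)
  rw [Real.norm_of_nonneg (by positivity)]
  simp only [Pi.add_apply]
  obtain ⟨s₁, s₂, s₃⟩ := hsep z
  have P : ∀ {e : ℝ} (p : E), 0 ≤ ‖z - p‖ ^ (-e) * max ‖z - p‖ r ^ (e - (a + b + c)) :=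
    fun p => by positivity
  have P₁ := P (e := a) p₁
  have P₂ := P (e := b) p₂
  have P₃ := P (e := c) p₃
  have big : ∀ {p p' : E}, ‖z - p‖ ≤ ‖z - p'‖ → (‖z - p‖ < r → r ≤ ‖z - p'‖) → r ≤ ‖z - p'‖ :=
    fun h h' => by
      by_contra hlt
      exact hlt (h' (h.trans_lt (not_le.1 hlt)))
  rcases le_total ‖z - p₁‖ ‖z - p₂‖ with h | h
  · rcases le_total ‖z - p₁‖ ‖z - p₃‖ with h' | h'
    · have := rpow_neg_mul_rpow_neg_mul_rpow_neg_le (a := a) hr hb.1 hc.1 (norm_nonneg _) h h'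
        (big h fun t => (s₁ t).1) (big h' fun t => (s₁ t).2)
      linarith
    · have := rpow_neg_mul_rpow_neg_mul_rpow_neg_le (a := c) hr ha.1 hb.1 (norm_nonneg _) h'
        (h'.trans h) (big h' fun t => (s₃ t).1) (big (h'.trans h) fun t => (s₃ t).2)
      rw [show c + a + b = a + b + c by ring] at this
      linarith
  · rcases le_total ‖z - p₂‖ ‖z - p₃‖ with h' | h'
    · have := rpow_neg_mul_rpow_neg_mul_rpow_neg_le (a := b) hr ha.1 hc.1 (norm_nonneg _) h h'
        (big h fun t => (s₂ t).1) (big h' fun t => (s₂ t).2)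
      rw [show b + a + c = a + b + c by ring] at this
      linarith
    · have := rpow_neg_mul_rpow_neg_mul_rpow_neg_le (a := c) hr ha.1 hb.1 (norm_nonneg _)
        (h'.trans h) h' (big (h'.trans h) fun t => (s₃ t).1) (big h' fun t => (s₃ t).2)
      rw [show c + a + b = a + b + c by ring] at this
      linarith

end ThreePoints

section PointAtInfinity

open Bornology

variable {E : Type*} [NormedAddCommGroup E]

lemma tendsto_norm_div_norm_sub_cobounded (z : E) :
    Tendsto (fun y : E => ‖y‖ / ‖z - y‖) (cobounded E) (nhds 1) := by
  have hy : Tendsto (fun y : E => ‖y‖) (cobounded E) atTop := tendsto_norm_cobounded_atTop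
  have hinv : Tendsto (fun y : E => ‖z - y‖ / ‖y‖) (cobounded E) (nhds 1) := by
    rw [tendsto_iff_norm_sub_tendsto_zero]
    refine squeeze_zero' (Eventually.of_forall fun _ => norm_nonneg _) ?_
      (hy.const_div_atTop ‖z‖)
    filter_upwards [hy.eventually_gt_atTop 0] with y hpos
    rw [div_sub_one hpos.ne', norm_div, norm_norm, Real.norm_eq_abs]
    gcongr
    simpa [norm_sub_rev z y] using abs_norm_sub_norm_le (y - z) y
  simpa using hinv.inv₀ one_ne_zero

lemma rpow_norm_sub_le_of_two_mul_norm_le {e : ℝ} (he : 0 ≤ e) {p z : E} (hz : z ≠ 0)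
    (hpz : 2 * ‖p‖ ≤ ‖z‖) : ‖z - p‖ ^ (-e) ≤ (‖z‖ / 2) ^ (-e) := by
  have hz : 0 < ‖z‖ := norm_pos_iff.2 hz
  have := norm_sub_norm_le z p
  exact Real.rpow_le_rpow_of_nonpos (by positivity) (by linarith) (neg_nonpos.2 he)

variable [NormedSpace ℝ E] [FiniteDimensional ℝ E] [MeasurableSpace E] [BorelSpace E]
  [Nontrivial E] (μ : Measure E) [μ.IsAddHaarMeasure]

/-- Sending the fourth point to infinity under the integral sign: the factor attached to it
drops out after rescaling. -/
lemma tendsto_integral_mul_norm_div_rpow_cobounded {f : E → ℝ} (hf : Integrable f μ)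
    {c s ρ M : ℝ} (hc₀ : 0 ≤ c) (hc : c < Module.finrank ℝ E) (hs : Module.finrank ℝ E < s)
    (hdecay : ∀ z, ρ ≤ ‖z‖ → |f z| ≤ M * ‖z‖ ^ (-s)) :
    Tendsto (fun y => ∫ z, f z * (‖y‖ / ‖z - y‖) ^ c ∂μ) (cobounded E)
      (nhds (∫ z, f z ∂μ)) := by
  have hy : Tendsto (fun y : E => ‖y‖) (cobounded E) atTop := tendsto_norm_cobounded_atTop
  set F : E → E → ℝ := fun y z => f z * (‖y‖ / ‖z - y‖) ^ c with hF
  set B : E → Set E := fun y => Metric.ball y (‖y‖ / 2) with hB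
  set h : E → ℝ := (Metric.ball (0 : E) 1).indicator fun w => ‖w‖ ^ (-c) with hh
  have h_int : Integrable h μ :=
    (integrable_indicator_iff measurableSet_ball).2 (integrableOn_ball_norm_rpow_neg μ hc 1)
  have hF_meas : ∀ y, AEStronglyMeasurable (F y) μ := fun y =>
    hf.aestronglyMeasurable.mul (Measurable.aestronglyMeasurable (by fun_prop))
  have far_le : ∀ y z, ‖(B y)ᶜ.indicator (F y) z‖ ≤ 2 ^ c * ‖f z‖ := by
    intro y z
    by_cases hz : z ∈ B y
    · rw [Set.indicator_of_notMem (by simpa using hz), norm_zero]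
      positivity
    · rw [Set.indicator_of_mem (by simpa using hz), norm_mul, mul_comm,
        Real.norm_of_nonneg (Real.rpow_nonneg (by positivity) _)]
      simp only [hB, Metric.mem_ball, dist_eq_norm, not_lt] at hz
      gcongr
      exact div_le_of_le_mul₀ (norm_nonneg _) zero_le_two (by linarith)
  have far_int : ∀ y, Integrable ((B y)ᶜ.indicator (F y)) μ := fun y =>
    (hf.norm.const_mul (2 ^ c)).mono' ((hF_meas y).indicator measurableSet_ball.compl)
      (ae_of_all _ (far_le y))
  have far_lim : Tendsto (fun y => ∫ z, (B y)ᶜ.indicator (F y) z ∂μ) (cobounded E)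
      (nhds (∫ z, f z ∂μ)) := by
    have : (cobounded E).IsCountablyGenerated := by
      rw [← comap_norm_atTop]
      infer_instance
    refine tendsto_integral_filter_of_dominated_convergence (fun z => 2 ^ c * ‖f z‖)
      (Eventually.of_forall fun y => (far_int y).aestronglyMeasurable)
      (Eventually.of_forall fun y => ae_of_all _ (far_le y))
      (hf.norm.const_mul _) (ae_of_all _ fun z => ?_)
    have hlim : Tendsto (fun y => F y z) (cobounded E) (nhds (f z)) := by
      simpa using ((tendsto_norm_div_norm_sub_cobounded z).rpow_const
        (p := c) (Or.inl one_ne_zero)).const_mul (f z)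
    refine hlim.congr' ?_
    filter_upwards [hy.eventually_ge_atTop (2 * ‖z‖)] with y hyz
    rw [Set.indicator_of_mem]
    simp only [hB, Set.mem_compl_iff, Metric.mem_ball, dist_eq_norm, not_lt]
    have := norm_sub_norm_le y z
    rw [norm_sub_rev] at this
    linarith
  have near_le : ∀ᶠ y in cobounded E, ∀ z, ‖(B y).indicator (F y) z‖ ≤
      2 ^ c * |M| * (‖y‖ / 2) ^ (-s) * h ((‖y‖ / 2)⁻¹ • (z - y)) := by
    filter_upwards [hy.eventually_gt_atTop 0, hy.eventually_ge_atTop (2 * ρ)] with y hpos hyρ z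
    have hR : 0 < ‖y‖ / 2 := by positivity
    by_cases hz : z ∈ B y
    · rw [Set.indicator_of_mem hz]
      simp only [hB, Metric.mem_ball, dist_eq_norm] at hz
      have hnorm : ‖(‖y‖ / 2)⁻¹ • (z - y)‖ = ‖z - y‖ / (‖y‖ / 2) := by
        rw [norm_smul, norm_inv, Real.norm_of_nonneg hR.le, inv_mul_eq_div]
      have hmem : (‖y‖ / 2)⁻¹ • (z - y) ∈ Metric.ball (0 : E) 1 := by
        rw [mem_ball_zero_iff, hnorm]
        exact (div_lt_one hR).2 hz
      have hzy : ‖y‖ / 2 ≤ ‖z‖ := by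
        have := norm_sub_norm_le y z
        rw [norm_sub_rev] at this
        linarith
      have hfz : |f z| ≤ |M| * (‖y‖ / 2) ^ (-s) :=
        (hdecay z (by linarith)).trans <| by
          have hs₀ : 0 ≤ s := by
            have : (0 : ℝ) ≤ Module.finrank ℝ E := Nat.cast_nonneg _
            linarith
          have := Real.rpow_le_rpow_of_nonpos hR hzy (neg_nonpos.2 hs₀)
          gcongr
          exact le_abs_self M
      have hratio : (‖y‖ / ‖z - y‖) ^ c = 2 ^ c * (‖z - y‖ / (‖y‖ / 2)) ^ (-c) := by
        rw [Real.rpow_neg (by positivity), ← Real.inv_rpow (by positivity),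
          ← Real.mul_rpow zero_le_two (by positivity), inv_div]
        congr 1
        ring
      rw [hh, Set.indicator_of_mem hmem, hnorm, norm_mul, Real.norm_eq_abs,
        Real.norm_of_nonneg (Real.rpow_nonneg (by positivity) _), hratio]
      calc |f z| * (2 ^ c * (‖z - y‖ / (‖y‖ / 2)) ^ (-c))
          ≤ |M| * (‖y‖ / 2) ^ (-s) * (2 ^ c * (‖z - y‖ / (‖y‖ / 2)) ^ (-c)) := by gcongr
        _ = _ := by ring
    · rw [Set.indicator_of_notMem hz, norm_zero]
      have : 0 ≤ h ((‖y‖ / 2)⁻¹ • (z - y)) :=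
        Set.indicator_nonneg (fun w _ => by positivity) _
      positivity
  have bound_int : ∀ᶠ y in cobounded E,
      Integrable (fun z => 2 ^ c * |M| * (‖y‖ / 2) ^ (-s) * h ((‖y‖ / 2)⁻¹ • (z - y))) μ := by
    filter_upwards [hy.eventually_gt_atTop 0] with y hpos
    have hR : (‖y‖ / 2)⁻¹ ≠ 0 := by positivity
    exact ((h_int.comp_smul hR).comp_sub_right y).const_mul _
  have near_int : ∀ᶠ y in cobounded E, Integrable ((B y).indicator (F y)) μ := by
    filter_upwards [near_le, bound_int] with y hle hint
    exact hint.mono' ((hF_meas y).indicator measurableSet_ball) (ae_of_all _ hle)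
  have near_lim : Tendsto (fun y => ∫ z, (B y).indicator (F y) z ∂μ) (cobounded E) (nhds 0) := by
    have hpow : Tendsto (fun y : E => 2 ^ c * |M| * (∫ w, h w ∂μ) *
        (‖y‖ / 2) ^ (-(s - Module.finrank ℝ E))) (cobounded E) (nhds 0) := by
      have := ((tendsto_rpow_neg_atTop (sub_pos.2 hs)).comp
        (hy.atTop_div_const zero_lt_two)).const_mul (2 ^ c * |M| * (∫ w, h w ∂μ))
      simpa using this
    refine squeeze_zero_norm' ?_ hpow
    filter_upwards [near_le, bound_int, hy.eventually_gt_atTop 0] with y hle hint hpos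
    have hR : 0 < ‖y‖ / 2 := by positivity
    refine (norm_integral_le_of_norm_le hint (ae_of_all _ hle)).trans_eq ?_
    rw [integral_const_mul, integral_sub_right_eq_self (fun z => h ((‖y‖ / 2)⁻¹ • z)),
      Measure.integral_comp_inv_smul_of_nonneg μ h hR.le, neg_sub, sub_eq_add_neg,
      Real.rpow_add hR, Real.rpow_natCast, smul_eq_mul]
    ring
  have hsum := far_lim.add near_lim
  rw [add_zero] at hsum
  refine hsum.congr' ?_
  filter_upwards [near_int] with y hint
  rw [← integral_add (far_int y) hint]
  exact integral_congr_ae (ae_of_all _ fun z =>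
    congrFun (Set.indicator_compl_add_self (B y) (F y)) z)

end PointAtInfinity

section Kinematics

variable {E : Type*} [NormedAddCommGroup E] [NormedSpace ℝ E] [FiniteDimensional ℝ E]
  [MeasurableSpace E] [BorelSpace E] (μ : Measure E) [μ.IsAddHaarMeasure]

/-- The dilation `z = q x₀` turns the thermal integrand into the three-point integrand. -/
lemma integral_thermal_eq_integral_three_point (a b c : ℝ) (x : E) {q : ℝ}
    (hq : q ∈ Set.Ioo (0 : ℝ) 1) :
    ∫ z, ‖z - x‖ ^ (-b) * ‖z - q • z‖ ^ (-c) * ‖x - q • z‖ ^ (-a) ∂μ =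
      q ^ (b + c - Module.finrank ℝ E) * (1 - q) ^ (-c) *
        ∫ z, ‖z - x‖ ^ (-a) * ‖z - q • x‖ ^ (-b) * ‖z - 0‖ ^ (-c) ∂μ := by
  obtain ⟨hq₀, hq₁⟩ := hq
  have h1q : 0 < 1 - q := sub_pos.2 hq₁
  have hpoint : ∀ z : E, ‖z - x‖ ^ (-b) * ‖z - q • z‖ ^ (-c) * ‖x - q • z‖ ^ (-a) =
      q ^ (b + c) * (1 - q) ^ (-c) *
        (‖q • z - x‖ ^ (-a) * ‖q • z - q • x‖ ^ (-b) * ‖q • z - 0‖ ^ (-c)) := by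
    intro z
    have e₁ : ‖z - q • z‖ = (1 - q) * ‖z‖ := by
      rw [show z - q • z = (1 - q) • z by module, norm_smul, Real.norm_of_nonneg h1q.le]
    have e₂ : ‖q • z - q • x‖ = q * ‖z - x‖ := by
      rw [← smul_sub, norm_smul, Real.norm_of_nonneg hq₀.le]
    have e₃ : ‖q • z - 0‖ = q * ‖z‖ := by
      rw [sub_zero, norm_smul, Real.norm_of_nonneg hq₀.le]
    rw [e₁, e₂, e₃, norm_sub_rev x, Real.mul_rpow h1q.le (norm_nonneg _),
      Real.mul_rpow hq₀.le (norm_nonneg _), Real.mul_rpow hq₀.le (norm_nonneg _),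
      Real.rpow_add hq₀]
    have hb : q ^ b * q ^ (-b) = 1 := by rw [← Real.rpow_add hq₀]; simp
    have hc : q ^ c * q ^ (-c) = 1 := by rw [← Real.rpow_add hq₀]; simp
    linear_combination (-(1 - q) ^ (-c) * ‖q • z - x‖ ^ (-a) * ‖z - x‖ ^ (-b) * ‖z‖ ^ (-c)) *
      (q ^ c * q ^ (-c) * hb + hc)
  simp_rw [hpoint]
  rw [integral_const_mul,
    Measure.integral_comp_smul_of_nonneg μ
      (fun z => ‖z - x‖ ^ (-a) * ‖z - q • x‖ ^ (-b) * ‖z - 0‖ ^ (-c)) q (hR := hq₀.le),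
    Real.rpow_sub hq₀, Real.rpow_natCast, smul_eq_mul]
  ring

end Kinematics

/-- The one-point thermal conformal partial wave arises as the diagonal limit
`x₂ = qx₁`, `x₃ = 0`, `x₄ → ∞` of the four-point `t`-channel flat-space conformal
partial wave with external dimensions `(Δ, Δφ, Δ, d-Δφ)` and exchanged dimension `Δ`:
as `‖y‖ → ∞`, `‖y‖^{2(d-Δφ)} Ψ(x, qx, 0, y)` converges to
`‖x‖^{(d-Δφ)-2Δ} q^{-Δ-Δφ} (1-q)^{d-Δφ} Υ(q,x)`. -/
theorem thermal_CPW_from_flat_CPW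
    (d : ℕ) (hd : 1 ≤ d) (Δ Δφ : ℝ)
    (hc₁ : (Δφ + 2 * Δ - d) / 2 ∈ Set.Ioo (0 : ℝ) ((d : ℝ) / 2))
    (hc₂ : (Δφ - 2 * Δ + d) / 2 ∈ Set.Ioo (0 : ℝ) ((d : ℝ) / 2))
    (hc₃ : ((d : ℝ) - Δφ) / 2 ∈ Set.Ioo (0 : ℝ) ((d : ℝ) / 2))
    (x : EuclideanSpace ℝ (Fin d)) (hx : x ≠ 0)
    (q : ℝ) (hq : q ∈ Set.Ioo (0 : ℝ) 1) :
    Tendsto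
      (fun y : EuclideanSpace ℝ (Fin d) =>
        ‖y‖ ^ (2 * ((d : ℝ) - Δφ)) * Psi d Δ Δφ x (q • x) 0 y)
      (comap (fun y : EuclideanSpace ℝ (Fin d) => ‖y‖) atTop)
      (nhds (‖x‖ ^ (((d : ℝ) - Δφ) - 2 * Δ) * q ^ (-Δ - Δφ) * (1 - q) ^ ((d : ℝ) - Δφ) *
        Upsilon d Δ Δφ q x)) := by
  have hfr : (Module.finrank ℝ (EuclideanSpace ℝ (Fin d)) : ℝ) = d := by simp
  have : Nonempty (Fin d) := ⟨⟨0, hd⟩⟩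
  obtain ⟨hq₀, hq₁⟩ := hq
  have hxn : 0 < ‖x‖ := norm_pos_iff.2 hx
  set a : ℝ := Δφ + 2 * Δ - d with ha
  set b : ℝ := Δφ - 2 * Δ + d with hb
  set c : ℝ := d - Δφ with hc
  have ha' : a ∈ Set.Ioo 0 (Module.finrank ℝ (EuclideanSpace ℝ (Fin d)) : ℝ) := by
    rw [hfr]; exact ⟨by linarith [hc₁.1], by linarith [hc₁.2]⟩
  have hb' : b ∈ Set.Ioo 0 (Module.finrank ℝ (EuclideanSpace ℝ (Fin d)) : ℝ) := by
    rw [hfr]; exact ⟨by linarith [hc₂.1], by linarith [hc₂.2]⟩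
  have hc' : c ∈ Set.Ioo 0 (Module.finrank ℝ (EuclideanSpace ℝ (Fin d)) : ℝ) := by
    rw [hfr]; exact ⟨by linarith [hc₃.1], by linarith [hc₃.2]⟩
  have habc : (Module.finrank ℝ (EuclideanSpace ℝ (Fin d)) : ℝ) < a + b + c := by
    rw [hfr]; linarith [hc₃.2]
  set f : EuclideanSpace ℝ (Fin d) → ℝ := fun z =>
    ‖z - x‖ ^ (-a) * ‖z - q • x‖ ^ (-b) * ‖z - 0‖ ^ (-c) with hf
  have hxq : x ≠ q • x := fun h => by
    have h0 : (1 - q) • x = 0 := by rw [sub_smul, one_smul, sub_eq_zero]; exact h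
    rcases smul_eq_zero.1 h0 with h1 | h1
    · linarith
    · exact hx h1
  have hf_int : Integrable f volume :=
    integrable_three_point_rpow volume ha' hb' hc' habc hxq hx (smul_ne_zero hq₀.ne' hx)
  have hdecay : ∀ z, 2 * ‖x‖ ≤ ‖z‖ → |f z| ≤ 2 ^ (a + b + c) * ‖z‖ ^ (-(a + b + c)) := by
    intro z hz
    have hzn : 0 < ‖z‖ := by linarith
    have hz₀ : z ≠ 0 := norm_pos_iff.1 hzn
    have hqx : 2 * ‖q • x‖ ≤ ‖z‖ := by
      rw [norm_smul, Real.norm_of_nonneg hq₀.le]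
      nlinarith
    rw [abs_of_nonneg (by positivity)]
    have e₁ := rpow_norm_sub_le_of_two_mul_norm_le ha'.1.le hz₀ hz
    have e₂ := rpow_norm_sub_le_of_two_mul_norm_le hb'.1.le hz₀ hqx
    have e₃ := rpow_norm_sub_le_of_two_mul_norm_le (p := 0) hc'.1.le hz₀ (by simp)
    calc f z ≤ (‖z‖ / 2) ^ (-a) * (‖z‖ / 2) ^ (-b) * (‖z‖ / 2) ^ (-c) := by
          simp only [hf]; gcongr
      _ = 2 ^ (a + b + c) * ‖z‖ ^ (-(a + b + c)) := by
          rw [← Real.rpow_add (by positivity), ← Real.rpow_add (by positivity),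
            show -a + -b + -c = -(a + b + c) by ring, Real.div_rpow hzn.le zero_le_two,
            Real.rpow_neg zero_le_two, div_inv_eq_mul, mul_comm]
  have hlim := tendsto_integral_mul_norm_div_rpow_cobounded volume hf_int hc'.1.le hc'.2 habc hdecay
  have hratio := (tendsto_norm_div_norm_sub_cobounded x).rpow_const (p := c) (Or.inl one_ne_zero)
  rw [comap_norm_atTop]
  have hUps : ‖x‖ ^ (c - 2 * Δ) * q ^ (-Δ - Δφ) * (1 - q) ^ c * Upsilon d Δ Δφ q x =
      1 ^ c * (‖q • x‖ ^ ((d : ℝ) - 2 * Δ - Δφ) * ∫ z, f z) := by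
    have hV : Upsilon d Δ Δφ q x =
        q ^ Δ * (q ^ (b + c - d) * (1 - q) ^ (-c) * ∫ z, f z) := by
      rw [← hfr, ← integral_thermal_eq_integral_three_point volume a b c x ⟨hq₀, hq₁⟩]
      simp only [Upsilon, Vthree, show Δ - (d - Δ) - Δφ = -b by ring,
        show Δφ - (d - Δ) - Δ = -c by ring, show d - Δ - Δφ - Δ = -a by ring]
    have h1 : (1 - q) ^ c * (1 - q) ^ (-c) = 1 := by
      rw [← Real.rpow_add (by linarith)]; simp
    have h2 : q ^ (-Δ - Δφ) * (q ^ Δ * q ^ (b + c - d)) = q ^ ((d : ℝ) - 2 * Δ - Δφ) := by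
      rw [← Real.rpow_add hq₀, ← Real.rpow_add hq₀]
      congr 1
      ring
    have h3 : c - 2 * Δ = (d : ℝ) - 2 * Δ - Δφ := by ring
    rw [hV, norm_smul, Real.norm_of_nonneg hq₀.le, Real.mul_rpow hq₀.le hxn.le, Real.one_rpow,
      ← h2, h3]
    linear_combination ‖x‖ ^ ((d : ℝ) - 2 * Δ - Δφ) * q ^ (-Δ - Δφ) * q ^ Δ * q ^ (b + c - d) *
      (∫ z, f z) * h1
  rw [hUps]
  refine (hratio.mul (hlim.const_mul _)).congr fun y => ?_
  have hsplit : ∀ z : EuclideanSpace ℝ (Fin d),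
      (‖y‖ / ‖z - y‖) ^ c = ‖y‖ ^ c * ‖z - y‖ ^ (-c) := fun z => by
    rw [Real.div_rpow (norm_nonneg _) (norm_nonneg _), Real.rpow_neg (norm_nonneg _),
      div_eq_mul_inv]
  have hint : ∫ z, f z * (‖y‖ / ‖z - y‖) ^ c =
      ‖y‖ ^ c * ∫ z, f z * ‖z - y‖ ^ (-c) := by
    rw [← integral_const_mul]
    refine integral_congr_ae (ae_of_all _ fun z => ?_)
    simp only [hsplit]
    ring
  have hsq : ‖y‖ ^ (2 * c) = ‖y‖ ^ c * ‖y‖ ^ c := by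
    rw [two_mul, Real.rpow_add_of_nonneg (norm_nonneg _) hc'.1.le hc'.1.le]
  rw [hint, hsplit, hsq]
  simp only [Psi, sub_zero, hf]
  ring
end

section
/- Let d ≥ 1 be an integer and let Δ, Δ_φ be real numbers such that each of c₁ = (Δ_φ + 2Δ − d)/2, c₂ = (Δ_φ − 2Δ + d)/2, c₃ = (d − Δ_φ)/2 lies in (0, d/2). Let x₁, x₂ ∈ ℝ^d be distinct nonzero points. Define the t-channel flat-space partial wave Ψ(x₁,x₂,x₃,x₄) = ‖x₁ − x₄‖^{−(d−Δ_φ)} · ‖x₂ − x₃‖^{d−2Δ−Δ_φ} · ∫_{ℝ^d} ‖x₀−x₁‖^{−2c₁} ‖x₀−x₂‖^{−2c₂} ‖x₀−x₃‖^{−2c₃} ‖x₀−x₄‖^{−2c₃} dx₀, and the bulk-channel defect partial wave for a point-like defect Θ(x₁,x₂) = ‖x₁ − x₂‖^{Δ_φ−d} · ∫_{ℝ^d} ‖x₀−x₁‖^{−2c₁} ‖x₀−x₂‖^{−2c₂} ‖x₀‖^{−2c₃} dx₀. Then, as ‖y‖ → ∞, the quantity ‖y‖^{2(d−Δ_φ)}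 · Ψ(x₁, x₂, 0, y) converges to ‖x₁ − x₂‖^{d−Δ_φ} · ‖x₂‖^{(d−Δ_φ)−2Δ} · Θ(x₁, x₂). (This is the correspondence between the four-point flat-space conformal partial wave with dimensions (Δ, Δ_φ, Δ, d−Δ_φ) and the two-point defect conformal partial wave with bulk dimensions (Δ, d−Δ) and exchanged dimension Δ_φ, valid for arbitrary x₁, x₂ without taking the diagonal limit.) -/
open MeasureTheory Filter

/-- The bulk-channel two-point conformal partial wave for a point-like defect with
bulk dimensions `(Δ, d-Δ)` and exchanged dimension `Δφ`. -/
noncomputable def Theta (d : ℕ) (Δ Δφ : ℝ)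
    (x₁ x₂ : EuclideanSpace ℝ (Fin d)) : ℝ :=
  ‖x₁ - x₂‖ ^ (Δφ - (d : ℝ)) *
    ∫ x₀ : EuclideanSpace ℝ (Fin d),
      ‖x₀ - x₁‖ ^ (-(Δφ + 2 * Δ - (d : ℝ))) * ‖x₀ - x₂‖ ^ (-(Δφ - 2 * Δ + (d : ℝ))) *
        ‖x₀‖ ^ (-((d : ℝ) - Δφ))

section RieszKernel

open Metric Module Topology

variable {E : Type*} [NormedAddCommGroup E]

/-- As `‖y‖ → ∞`, the kernel `‖x - y‖ ^ (-c)` is asymptotic to `‖y‖ ^ (-c)`. -/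
lemma tendsto_norm_rpow_mul_norm_sub_rpow_neg (x : E) (c : ℝ) :
    Tendsto (fun y : E => ‖y‖ ^ c * ‖x - y‖ ^ (-c)) (comap (fun y : E => ‖y‖) atTop) (𝓝 1) := by
  have hnorm : Tendsto (fun y : E => ‖y‖) (comap (fun y : E => ‖y‖) atTop) atTop :=
    tendsto_comap
  have hratio : Tendsto (fun y : E => ‖x - y‖ / ‖y‖) (comap (fun y : E => ‖y‖) atTop) (𝓝 1) := by
    rw [tendsto_iff_norm_sub_tendsto_zero]
    refine squeeze_zero' (Eventually.of_forall fun _ => norm_nonneg _) ?_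
      (hnorm.const_div_atTop ‖x‖)
    filter_upwards [hnorm.eventually_gt_atTop 0] with y hy
    rw [div_sub_one hy.ne', norm_div, norm_norm]
    gcongr
    rw [Real.norm_eq_abs, norm_sub_rev x y]
    have h := abs_norm_sub_norm_le (y - x) y
    simpa using h
  have hpow := hratio.rpow_const (p := -c) (Or.inl one_ne_zero)
  rw [Real.one_rpow] at hpow
  refine hpow.congr' ?_
  filter_upwards [hnorm.eventually_gt_atTop 0] with y hy
  rw [Real.div_rpow (norm_nonneg _) hy.le, Real.rpow_neg hy.le, div_inv_eq_mul, mul_comm]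

/-- Away from a ball around `p`, the distance to `p` is comparable with `1 + ‖x‖`. -/
lemma exists_mul_one_add_norm_le_norm_sub (p : E) {ρ : ℝ} (hρ : 0 < ρ) :
    ∃ k > 0, ∀ x ∉ ball p ρ, k * (1 + ‖x‖) ≤ ‖x - p‖ := by
  have hK : 0 < 1 + ‖p‖ + ρ := by positivity
  refine ⟨ρ / (1 + ‖p‖ + ρ), by positivity, fun x hx => ?_⟩
  rw [mem_ball, dist_eq_norm, not_lt] at hx
  have htri : ‖x‖ ≤ ‖x - p‖ + ‖p‖ := by simpa using norm_add_le (x - p) p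
  rw [div_mul_eq_mul_div, div_le_iff₀ hK]
  nlinarith [norm_nonneg p]

variable [NormedSpace ℝ E] [FiniteDimensional ℝ E] [MeasurableSpace E] [BorelSpace E]
  (μ : Measure E) [μ.IsAddHaarMeasure]

lemma integrableOn_ball_norm_sub_rpow_neg (hdim : 1 ≤ finrank ℝ E) {s : ℝ}
    (hs : s < finrank ℝ E) (p : E) (r : ℝ) :
    IntegrableOn (fun x => ‖x - p‖ ^ (-s)) (ball p r) μ := by
  have h0 : IntegrableOn (fun x : E => ‖x‖ ^ (-s)) (ball 0 r) μ :=
    integrableOn_ball_of_norm_le_rpow (C := 1) hdim hs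
      (Eventually.of_forall fun x => by
        rw [one_mul, Real.norm_of_nonneg (Real.rpow_nonneg (norm_nonneg _) _)])
      (Measurable.aestronglyMeasurable (by fun_prop))
  rw [← integrable_indicator_iff measurableSet_ball] at h0 ⊢
  refine (h0.comp_sub_right p).congr (Eventually.of_forall fun x => ?_)
  simp [Set.indicator, dist_eq_norm]

lemma setIntegral_ball_norm_sub_rpow_neg (s : ℝ) (p : E) {r : ℝ} (hr : 0 < r) :
    ∫ x in ball p r, ‖x - p‖ ^ (-s) ∂μ =
      r ^ ((finrank ℝ E : ℝ) - s) * ∫ x in ball (0 : E) 1, ‖x‖ ^ (-s) ∂μ := by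
  have htrans : ∫ x in ball p r, ‖x - p‖ ^ (-s) ∂μ = ∫ x in ball (0 : E) r, ‖x‖ ^ (-s) ∂μ := by
    rw [← integral_indicator measurableSet_ball, ← integral_indicator measurableSet_ball,
      ← integral_sub_right_eq_self ((ball (0 : E) r).indicator _) p]
    congr 1 with x
    simp [Set.indicator, dist_eq_norm]
  have hscale := Measure.setIntegral_comp_smul_of_pos μ (fun x : E => ‖x‖ ^ (-s)) (ball 0 1) hr
  rw [smul_unitBall_of_pos hr] at hscale
  simp only [norm_smul, Real.norm_of_nonneg hr.le, Real.mul_rpow hr.le (norm_nonneg _),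
    integral_const_mul, smul_eq_mul] at hscale
  have hpow : 0 < r ^ finrank ℝ E := by positivity
  rw [htrans, sub_eq_add_neg, Real.rpow_add hr, Real.rpow_natCast, mul_assoc, hscale,
    mul_inv_cancel_left₀ hpow.ne']

/-- A Riesz kernel times a function that is bounded on a ball around its singular point is
integrable on that ball. -/
lemma integrableOn_ball_mul_norm_sub_rpow_neg (hdim : 1 ≤ finrank ℝ E) {s ρ C : ℝ}
    (hs : s < finrank ℝ E) (p : E) {g : E → ℝ} (hg : Measurable g)
    (hgC : ∀ x ∈ ball p ρ, ‖g x‖ ≤ C) :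
    IntegrableOn (fun x => g x * ‖x - p‖ ^ (-s)) (ball p ρ) μ :=
  (integrableOn_ball_norm_sub_rpow_neg μ hdim hs p ρ).bdd_mul hg.aestronglyMeasurable
    ((ae_restrict_iff' measurableSet_ball).2 (Eventually.of_forall hgC))

/-- A product of three Riesz kernels with distinct singular points is integrable if each of them
is locally integrable and their product decays fast enough at infinity. -/
lemma integrable_norm_sub_rpow_neg_mul_mul (hdim : 1 ≤ finrank ℝ E) {a b c : ℝ}
    (ha : a ∈ Set.Ioo (0 : ℝ) (finrank ℝ E)) (hb : b ∈ Set.Ioo (0 : ℝ) (finrank ℝ E))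
    (hc : c ∈ Set.Ioo (0 : ℝ) (finrank ℝ E)) (habc : (finrank ℝ E : ℝ) < a + b + c)
    {p q r : E} (hpq : p ≠ q) (hpr : p ≠ r) (hqr : q ≠ r) :
    Integrable (fun x => ‖x - p‖ ^ (-a) * ‖x - q‖ ^ (-b) * ‖x - r‖ ^ (-c)) μ := by
  obtain ⟨ρ, hρ, hρpq, hρpr, hρqr⟩ :
      ∃ ρ > 0, 2 * ρ ≤ dist p q ∧ 2 * ρ ≤ dist p r ∧ 2 * ρ ≤ dist q r := by
    refine ⟨min (dist p q) (min (dist p r) (dist q r)) / 2, ?_, ?_, ?_, ?_⟩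
    · have := dist_pos.2 hpq
      have := dist_pos.2 hpr
      have := dist_pos.2 hqr
      positivity
    all_goals simp [mul_div_cancel₀]
  have hfar : ∀ {u v x : E}, 2 * ρ ≤ dist u v → x ∈ ball u ρ → ∀ {s : ℝ}, 0 < s →
      ‖x - v‖ ^ (-s) ≤ ρ ^ (-s) := by
    intro u v x huv hx s hs
    refine Real.rpow_le_rpow_of_nonpos hρ ?_ (by linarith)
    rw [← dist_eq_norm]
    have := dist_triangle_left u v x
    rw [mem_ball] at hx
    linarith
  have hprod : ∀ {u v w x : E}, 2 * ρ ≤ dist u v → 2 * ρ ≤ dist u w → x ∈ ball u ρ →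
      ∀ {s t : ℝ}, 0 < s → 0 < t →
      ‖‖x - v‖ ^ (-s) * ‖x - w‖ ^ (-t)‖ ≤ ρ ^ (-s) * ρ ^ (-t) := by
    intro u v w x huv huw hx s t hs ht
    rw [Real.norm_of_nonneg (by positivity)]
    exact mul_le_mul (hfar huv hx hs) (hfar huw hx ht) (by positivity) (by positivity)
  have hp := integrableOn_ball_mul_norm_sub_rpow_neg μ hdim ha.2 p (ρ := ρ)
    (g := fun x => ‖x - q‖ ^ (-b) * ‖x - r‖ ^ (-c)) (by fun_prop)
    fun x hx => hprod hρpq hρpr hx hb.1 hc.1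
  have hq := integrableOn_ball_mul_norm_sub_rpow_neg μ hdim hb.2 q (ρ := ρ)
    (g := fun x => ‖x - p‖ ^ (-a) * ‖x - r‖ ^ (-c)) (by fun_prop)
    fun x hx => hprod (by rwa [dist_comm]) hρqr hx ha.1 hc.1
  have hr := integrableOn_ball_mul_norm_sub_rpow_neg μ hdim hc.2 r (ρ := ρ)
    (g := fun x => ‖x - p‖ ^ (-a) * ‖x - q‖ ^ (-b)) (by fun_prop)
    fun x hx => hprod (by rwa [dist_comm]) (by rwa [dist_comm]) hx ha.1 hb.1
  have hinfty : IntegrableOn (fun x => ‖x - p‖ ^ (-a) * ‖x - q‖ ^ (-b) * ‖x - r‖ ^ (-c))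
      (ball p ρ ∪ ball q ρ ∪ ball r ρ)ᶜ μ := by
    obtain ⟨k, hk, hkp⟩ := exists_mul_one_add_norm_le_norm_sub p hρ
    obtain ⟨l, hl, hlq⟩ := exists_mul_one_add_norm_le_norm_sub q hρ
    obtain ⟨m, hm, hmr⟩ := exists_mul_one_add_norm_le_norm_sub r hρ
    refine Integrable.mono' (((integrable_one_add_norm (μ := μ) habc).const_mul
      (k ^ (-a) * l ^ (-b) * m ^ (-c))).integrableOn) (by fun_prop) ?_
    refine (ae_restrict_iff' (by measurability)).2 (Eventually.of_forall fun x hx => ?_)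
    simp only [Set.mem_compl_iff, Set.mem_union, not_or] at hx
    obtain ⟨⟨hxp, hxq⟩, hxr⟩ := hx
    have hx1 : 0 < 1 + ‖x‖ := by positivity
    rw [Real.norm_of_nonneg (by positivity)]
    calc ‖x - p‖ ^ (-a) * ‖x - q‖ ^ (-b) * ‖x - r‖ ^ (-c)
        ≤ (k * (1 + ‖x‖)) ^ (-a) * (l * (1 + ‖x‖)) ^ (-b) * (m * (1 + ‖x‖)) ^ (-c) := by
          gcongr ?_ * ?_ * ?_
          · exact Real.rpow_le_rpow_of_nonpos (by positivity) (hkp x hxp) (by linarith [ha.1])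
          · exact Real.rpow_le_rpow_of_nonpos (by positivity) (hlq x hxq) (by linarith [hb.1])
          · exact Real.rpow_le_rpow_of_nonpos (by positivity) (hmr x hxr) (by linarith [hc.1])
      _ = k ^ (-a) * l ^ (-b) * m ^ (-c) * (1 + ‖x‖) ^ (-(a + b + c)) := by
          rw [Real.mul_rpow hk.le hx1.le, Real.mul_rpow hl.le hx1.le, Real.mul_rpow hm.le hx1.le,
            neg_add, neg_add, Real.rpow_add hx1, Real.rpow_add hx1]
          ring
  rw [← integrableOn_univ, ← Set.union_compl_self (ball p ρ ∪ ball q ρ ∪ ball r ρ)]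
  refine IntegrableOn.union (IntegrableOn.union (IntegrableOn.union ?_ ?_) ?_) hinfty
  · exact hp.congr_fun (fun x _ => by ring) measurableSet_ball
  · exact hq.congr_fun (fun x _ => by ring) measurableSet_ball
  · exact hr

/-- If `F` is integrable and decays like `‖x‖ ^ (-e)` with `e > dim E`, then its Riesz potential
`∫ F x * ‖x - y‖ ^ (-c)` is asymptotic to `‖y‖ ^ (-c) * ∫ F x`. -/
lemma tendsto_norm_rpow_mul_integral_mul_norm_sub_rpow_neg (hdim : 1 ≤ finrank ℝ E) {c e C R : ℝ}
    (hc : c ∈ Set.Ioo (0 : ℝ) (finrank ℝ E)) (he : (finrank ℝ E : ℝ) < e) {F : E → ℝ}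
    (hF : Integrable F μ) (hFC : ∀ x, R ≤ ‖x‖ → ‖F x‖ ≤ C * ‖x‖ ^ (-e)) :
    Tendsto (fun y : E => ‖y‖ ^ c * ∫ x, F x * ‖x - y‖ ^ (-c) ∂μ)
      (comap (fun y : E => ‖y‖) atTop) (𝓝 (∫ x, F x ∂μ)) := by
  have hnorm : Tendsto (fun y : E => ‖y‖) (comap (fun y : E => ‖y‖) atTop) atTop :=
    tendsto_comap
  have hkernel : ∀ y : E, AEStronglyMeasurable (fun x => ‖x - y‖ ^ (-c)) μ :=
    fun y => Measurable.aestronglyMeasurable (by fun_prop)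
  have hfar : ∀ y : E, 0 < ‖y‖ → ∀ x ∉ ball y (‖y‖ / 2),
      ‖‖y‖ ^ c * (F x * ‖x - y‖ ^ (-c))‖ ≤ 2 ^ c * ‖F x‖ := by
    intro y hy x hx
    rw [mem_ball, dist_eq_norm, not_lt] at hx
    have hle : ‖x - y‖ ^ (-c) ≤ (‖y‖ / 2) ^ (-c) :=
      Real.rpow_le_rpow_of_nonpos (by positivity) hx (by linarith [hc.1])
    have hval : ‖y‖ ^ c * (‖y‖ / 2) ^ (-c) = 2 ^ c := by
      have := Real.rpow_pos_of_pos hy c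
      rw [Real.rpow_neg (by positivity), Real.div_rpow hy.le zero_le_two]
      field_simp
    rw [norm_mul, norm_mul, Real.norm_of_nonneg (by positivity),
      Real.norm_of_nonneg (r := ‖x - y‖ ^ (-c)) (by positivity), ← hval]
    calc ‖y‖ ^ c * (‖F x‖ * ‖x - y‖ ^ (-c)) ≤ ‖y‖ ^ c * (‖F x‖ * (‖y‖ / 2) ^ (-c)) := by gcongr
      _ = ‖y‖ ^ c * (‖y‖ / 2) ^ (-c) * ‖F x‖ := by ring
  have hnear : ∀ y : E, 0 < ‖y‖ → 2 * R ≤ ‖y‖ → ∀ x ∈ ball y (‖y‖ / 2),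
      ‖‖y‖ ^ c * (F x * ‖x - y‖ ^ (-c))‖ ≤
        ‖y‖ ^ c * (|C| * (‖y‖ / 2) ^ (-e)) * ‖x - y‖ ^ (-c) := by
    intro y hy hyR x hx
    rw [mem_ball, dist_eq_norm] at hx
    have hxy : ‖y‖ / 2 ≤ ‖x‖ := by
      have := norm_sub_norm_le y x
      rw [norm_sub_rev] at this
      linarith
    have hFx : ‖F x‖ ≤ |C| * (‖y‖ / 2) ^ (-e) :=
      calc ‖F x‖ ≤ C * ‖x‖ ^ (-e) := hFC x (by linarith)
        _ ≤ |C| * ‖x‖ ^ (-e) := by gcongr; exact le_abs_self C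
        _ ≤ |C| * (‖y‖ / 2) ^ (-e) := by
          gcongr ?_ * ?_
          exact Real.rpow_le_rpow_of_nonpos (by positivity) hxy
            (by linarith [(Nat.cast_nonneg (finrank ℝ E) : (0 : ℝ) ≤ _)])
    rw [norm_mul, norm_mul, Real.norm_of_nonneg (by positivity),
      Real.norm_of_nonneg (r := ‖x - y‖ ^ (-c)) (by positivity), mul_assoc]
    gcongr
  have hfarInt : ∀ y : E, 0 < ‖y‖ → IntegrableOn
      (fun x => ‖y‖ ^ c * (F x * ‖x - y‖ ^ (-c))) (ball y (‖y‖ / 2))ᶜ μ := fun y hy =>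
    Integrable.mono' (hF.norm.const_mul (2 ^ c)).integrableOn
      ((hF.aestronglyMeasurable.mul (hkernel y)).const_mul _).restrict
      ((ae_restrict_iff' measurableSet_ball.compl).2 (Eventually.of_forall (hfar y hy)))
  have hnearInt : ∀ y : E, 0 < ‖y‖ → 2 * R ≤ ‖y‖ → IntegrableOn
      (fun x => ‖y‖ ^ c * (F x * ‖x - y‖ ^ (-c))) (ball y (‖y‖ / 2)) μ := fun y hy hyR =>
    Integrable.mono' ((integrableOn_ball_norm_sub_rpow_neg μ hdim hc.2 y _).const_mul _)
      ((hF.aestronglyMeasurable.mul (hkernel y)).const_mul _).restrict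
      ((ae_restrict_iff' measurableSet_ball).2 (Eventually.of_forall (hnear y hy hyR)))
  have hfarLim : Tendsto
      (fun y : E => ∫ x in (ball y (‖y‖ / 2))ᶜ, ‖y‖ ^ c * (F x * ‖x - y‖ ^ (-c)) ∂μ)
      (comap (fun y : E => ‖y‖) atTop) (𝓝 (∫ x, F x ∂μ)) := by
    simp_rw [← integral_indicator measurableSet_ball.compl]
    refine tendsto_integral_filter_of_dominated_convergence (fun x => 2 ^ c * ‖F x‖)
      (Eventually.of_forall fun y =>
        ((hF.aestronglyMeasurable.mul (hkernel y)).const_mul _).indicator measurableSet_ball.compl)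
      ?_ (hF.norm.const_mul _) (Eventually.of_forall fun x => ?_)
    · filter_upwards [hnorm.eventually_gt_atTop 0] with y hy
      refine Eventually.of_forall fun x => ?_
      by_cases hx : x ∈ ball y (‖y‖ / 2)
      · rw [Set.indicator_of_notMem (by simpa using hx), norm_zero]
        positivity
      · rw [Set.indicator_of_mem hx]
        exact hfar y hy x hx
    · have hlim := (tendsto_norm_rpow_mul_norm_sub_rpow_neg x c).const_mul (F x)
      rw [mul_one] at hlim
      refine hlim.congr' ?_
      filter_upwards [hnorm.eventually_ge_atTop (2 * ‖x‖)] with y hy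
      rw [Set.indicator_of_mem]
      · ring
      · rw [Set.mem_compl_iff, mem_ball, dist_eq_norm, not_lt, norm_sub_rev]
        linarith [norm_sub_norm_le y x]
  have hnearLim : Tendsto
      (fun y : E => ∫ x in ball y (‖y‖ / 2), ‖y‖ ^ c * (F x * ‖x - y‖ ^ (-c)) ∂μ)
      (comap (fun y : E => ‖y‖) atTop) (𝓝 0) := by
    set K : ℝ := ∫ x in ball (0 : E) 1, ‖x‖ ^ (-c) ∂μ
    have hdecay : Tendsto
        (fun y : E => 2 ^ c * |C| * K * (‖y‖ / 2) ^ (-(e - finrank ℝ E)))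
        (comap (fun y : E => ‖y‖) atTop) (𝓝 0) := by
      have := ((tendsto_rpow_neg_atTop (sub_pos.2 he)).comp
        (hnorm.atTop_div_const zero_lt_two)).const_mul (2 ^ c * |C| * K)
      rwa [mul_zero] at this
    refine squeeze_zero_norm' ?_ hdecay
    filter_upwards [hnorm.eventually_gt_atTop 0, hnorm.eventually_ge_atTop (2 * R)] with y hy hyR
    refine (norm_integral_le_of_norm_le
      ((integrableOn_ball_norm_sub_rpow_neg μ hdim hc.2 y (‖y‖ / 2)).const_mul _)
      ((ae_restrict_iff' measurableSet_ball).2 (Eventually.of_forall (hnear y hy hyR)))).trans ?_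
    have hy2 : 0 < ‖y‖ / 2 := by positivity
    rw [integral_const_mul, setIntegral_ball_norm_sub_rpow_neg μ c y hy2]
    refine le_of_eq ?_
    have hsplit : ‖y‖ ^ c = 2 ^ c * (‖y‖ / 2) ^ c := by
      rw [← Real.mul_rpow zero_le_two hy2.le, mul_div_cancel₀ _ two_ne_zero]
    have hexp : (‖y‖ / 2) ^ (-(e - finrank ℝ E)) =
        (‖y‖ / 2) ^ c * (‖y‖ / 2) ^ (-e) * (‖y‖ / 2) ^ ((finrank ℝ E : ℝ) - c) := by
      rw [← Real.rpow_add hy2, ← Real.rpow_add hy2]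
      congr 1
      ring
    rw [hsplit, hexp]
    ring
  have hsum := hnearLim.add hfarLim
  rw [zero_add] at hsum
  refine hsum.congr' ?_
  filter_upwards [hnorm.eventually_gt_atTop 0, hnorm.eventually_ge_atTop (2 * R)] with y hy hyR
  rw [← integral_const_mul]
  refine integral_add_compl measurableSet_ball ?_
  rw [← integrableOn_univ, ← Set.union_compl_self (ball y (‖y‖ / 2))]
  exact (hnearInt y hy hyR).union (hfarInt y hy)

end RieszKernel

/-- Correspondence between the four-point flat-space conformal partial wave with
dimensions `(Δ, Δφ, Δ, d-Δφ)` and the two-point defect conformal partial wave with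
bulk dimensions `(Δ, d-Δ)` and exchanged dimension `Δφ`, valid for arbitrary
`x₁, x₂` without taking the diagonal limit: as `‖y‖ → ∞`,
`‖y‖^{2(d-Δφ)} Ψ(x₁, x₂, 0, y)` converges to
`‖x₁-x₂‖^{d-Δφ} ‖x₂‖^{(d-Δφ)-2Δ} Θ(x₁, x₂)`. -/
theorem defect_CPW_from_flat_CPW
    (d : ℕ) (hd : 1 ≤ d) (Δ Δφ : ℝ)
    (hc₁ : (Δφ + 2 * Δ - d) / 2 ∈ Set.Ioo (0 : ℝ) ((d : ℝ) / 2))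
    (hc₂ : (Δφ - 2 * Δ + d) / 2 ∈ Set.Ioo (0 : ℝ) ((d : ℝ) / 2))
    (hc₃ : ((d : ℝ) - Δφ) / 2 ∈ Set.Ioo (0 : ℝ) ((d : ℝ) / 2))
    (x₁ x₂ : EuclideanSpace ℝ (Fin d))
    (hx₁ : x₁ ≠ 0) (hx₂ : x₂ ≠ 0) (hne : x₁ ≠ x₂) :
    Tendsto
      (fun y : EuclideanSpace ℝ (Fin d) =>
        ‖y‖ ^ (2 * ((d : ℝ) - Δφ)) * Psi d Δ Δφ x₁ x₂ 0 y)
      (comap (fun y : EuclideanSpace ℝ (Fin d) => ‖y‖) atTop)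
      (nhds (‖x₁ - x₂‖ ^ ((d : ℝ) - Δφ) * ‖x₂‖ ^ (((d : ℝ) - Δφ) - 2 * Δ) *
        Theta d Δ Δφ x₁ x₂)) := by
  have hfin : Module.finrank ℝ (EuclideanSpace ℝ (Fin d)) = d := by simp
  set a : ℝ := Δφ + 2 * Δ - d with ha_def
  set b : ℝ := Δφ - 2 * Δ + d with hb_def
  set c : ℝ := d - Δφ with hc_def
  have ha : a ∈ Set.Ioo (0 : ℝ) d := ⟨by linarith [hc₁.1], by linarith [hc₁.2]⟩
  have hb : b ∈ Set.Ioo (0 : ℝ) d := ⟨by linarith [hc₂.1], by linarith [hc₂.2]⟩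
  have hc : c ∈ Set.Ioo (0 : ℝ) d := ⟨by linarith [hc₃.1], by linarith [hc₃.2]⟩
  have habc : (d : ℝ) < a + b + c := by linarith [hc.2]
  set F : EuclideanSpace ℝ (Fin d) → ℝ :=
    fun x => ‖x - x₁‖ ^ (-a) * ‖x - x₂‖ ^ (-b) * ‖x‖ ^ (-c) with hF_def
  have hF : Integrable F := by
    have := integrable_norm_sub_rpow_neg_mul_mul volume (a := a) (b := b) (c := c)
      (by rwa [hfin]) (by rwa [hfin]) (by rwa [hfin]) (by rwa [hfin]) (by rwa [hfin])
      hne hx₁ hx₂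
    simpa only [sub_zero] using this
  have hF_decay : ∀ x, 2 * (‖x₁‖ + ‖x₂‖) + 1 ≤ ‖x‖ →
      ‖F x‖ ≤ (2 ^ a * 2 ^ b) * ‖x‖ ^ (-(a + b + c)) := by
    intro x hx
    have hx_pos : 0 < ‖x‖ := by linarith [norm_nonneg x₁, norm_nonneg x₂]
    have hhalf : ∀ {z : EuclideanSpace ℝ (Fin d)} {s : ℝ}, 2 * ‖z‖ ≤ ‖x‖ → 0 < s →
        ‖x - z‖ ^ (-s) ≤ 2 ^ s * ‖x‖ ^ (-s) := by
      intro z s hz hs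
      calc ‖x - z‖ ^ (-s) ≤ (‖x‖ / 2) ^ (-s) :=
            Real.rpow_le_rpow_of_nonpos (by positivity)
              (by linarith [norm_sub_norm_le x z]) (by linarith)
        _ = 2 ^ s * ‖x‖ ^ (-s) := by
            rw [Real.div_rpow hx_pos.le zero_le_two, Real.rpow_neg zero_le_two, div_inv_eq_mul,
              mul_comm]
    rw [Real.norm_of_nonneg (by positivity)]
    calc F x ≤ 2 ^ a * ‖x‖ ^ (-a) * (2 ^ b * ‖x‖ ^ (-b)) * ‖x‖ ^ (-c) := by
          simp only [hF_def]
          gcongr ?_ * ?_ * _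
          · exact hhalf (by linarith [norm_nonneg x₂]) ha.1
          · exact hhalf (by linarith [norm_nonneg x₁]) hb.1
      _ = (2 ^ a * 2 ^ b) * ‖x‖ ^ (-(a + b + c)) := by
          rw [show -(a + b + c) = -a + -b + -c by ring, Real.rpow_add hx_pos, Real.rpow_add hx_pos]
          ring
  have hpotential := tendsto_norm_rpow_mul_integral_mul_norm_sub_rpow_neg volume (c := c)
    (by rwa [hfin]) (by rwa [hfin]) (by rwa [hfin]) hF hF_decay
  have hlim := ((tendsto_norm_rpow_mul_norm_sub_rpow_neg x₁ c).mul hpotential).const_mul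
    (‖x₂‖ ^ (c - 2 * Δ))
  have hvalue : ‖x₁ - x₂‖ ^ c * ‖x₂‖ ^ (c - 2 * Δ) * Theta d Δ Δφ x₁ x₂ =
      ‖x₂‖ ^ (c - 2 * Δ) * (1 * ∫ x, F x) := by
    have hpos : 0 < ‖x₁ - x₂‖ := norm_pos_iff.2 (sub_ne_zero.2 hne)
    have hcancel : ‖x₁ - x₂‖ ^ c * ‖x₁ - x₂‖ ^ (Δφ - d) = 1 := by
      rw [← Real.rpow_add hpos, hc_def, sub_add_sub_cancel, sub_self, Real.rpow_zero]
    simp only [Theta, ← ha_def, ← hb_def, ← hc_def]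
    linear_combination (‖x₂‖ ^ (c - 2 * Δ) * ∫ x, F x) * hcancel
  rw [hvalue]
  refine hlim.congr' ?_
  filter_upwards [tendsto_comap.eventually_gt_atTop (0 : ℝ)] with y hy
  simp only [Psi, sub_zero, ← ha_def, ← hb_def, ← hc_def]
  rw [two_mul c, Real.rpow_add hy, show (d : ℝ) - 2 * Δ - Δφ = c - 2 * Δ by rw [hc_def]; ring]
  ring
end
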